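/- arXiv:1604.02159 — 3 statements merged into one kernel-verified Lean document; each statement's English description precedes it below -/
import Mathlib

section
/- Every element of PU(2,1) is the square of a triple product of involutions (equivalently, the commutator of a ℂ-decomposable pair): for every 3×3 complex matrix A with Aᴴ J A = J there exist involutive lifts I₁, I₂, I₃ and a nonzero scalar λ ∈ ℂ such that A = λ · (I₁ I₂ I₃)². -/
open Matrix

/-- The Hermitian form of signature (2,1) on ℂ³ (ball model). -/
noncomputable def Jball : Matrix (Fin 3) (Fin 3) ℂ := Matrix.diagonal ![1, 1, -1]

/-- Membership in U(2,1). -/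
def InU21 (A : Matrix (Fin 3) (Fin 3) ℂ) : Prop := Aᴴ * Jball * A = Jball

/-- An involutive lift: a matrix in U(2,1) squaring to the identity with trace −1.
These are exactly the distinguished lifts of holomorphic involutions of H²_ℂ. -/
def IsInvLift (I : Matrix (Fin 3) (Fin 3) ℂ) : Prop :=
  InU21 I ∧ I * I = 1 ∧ I.trace = -1

/-- The sesquilinear form on `ℂ³` with matrix `G`, conjugate-linear in the first argument. -/
noncomputable def sesq (G : Matrix (Fin 3) (Fin 3) ℂ) (x y : Fin 3 → ℂ) : ℂ :=
  star x ⬝ᵥ (G *ᵥ y)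

section Sesq

variable (G : Matrix (Fin 3) (Fin 3) ℂ) (x y z : Fin 3 → ℂ) (c : ℂ)

theorem sesq_add_left : sesq G (x + y) z = sesq G x z + sesq G y z := by
  simp [sesq, add_dotProduct]

theorem sesq_add_right : sesq G x (y + z) = sesq G x y + sesq G x z := by
  simp [sesq, mulVec_add]

theorem sesq_smul_left : sesq G (c • x) y = star c * sesq G x y := by
  simp [sesq]

theorem sesq_smul_right : sesq G x (c • y) = c * sesq G x y := by
  simp [sesq, mulVec_smul]

theorem sesq_zero_right : sesq G x 0 = 0 := by
  simp [sesq]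

theorem sesq_mulVec (A : Matrix (Fin 3) (Fin 3) ℂ) :
    sesq G (A *ᵥ x) (A *ᵥ y) = sesq (Aᴴ * G * A) x y := by
  simp [sesq, star_mulVec, dotProduct_mulVec, vecMul_vecMul, Matrix.mul_assoc]

end Sesq

theorem eq_of_sesq_eq {G H : Matrix (Fin 3) (Fin 3) ℂ} (h : ∀ x y, sesq G x y = sesq H x y) :
    G = H := by
  ext i j
  simpa [sesq, Pi.single_star, ← Pi.single_star] using h (Pi.single i 1) (Pi.single j 1)

theorem sesq_Jball (x y : Fin 3 → ℂ) :
    sesq Jball x y = star (x 0) * y 0 + star (x 1) * y 1 - star (x 2) * y 2 := by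
  simp [sesq, Jball, dotProduct, Fin.sum_univ_three, mulVec_diagonal]
  ring

theorem star_sesq_Jball (x y : Fin 3 → ℂ) : star (sesq Jball x y) = sesq Jball y x := by
  simp only [sesq_Jball, star_sub, star_add, star_mul', star_star]
  ring

theorem sesq_Jball_self (x : Fin 3 → ℂ) :
    sesq Jball x x =
      ((Complex.normSq (x 0) + Complex.normSq (x 1) - Complex.normSq (x 2) : ℝ) : ℂ) := by
  rw [sesq_Jball]
  push_cast
  simp only [Complex.normSq_eq_conj_mul_self, Complex.star_def]

theorem InU21.sesq_mulVec {A : Matrix (Fin 3) (Fin 3) ℂ} (hA : InU21 A) (x y : Fin 3 → ℂ) :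
    sesq Jball (A *ᵥ x) (A *ᵥ y) = sesq Jball x y := by
  rw [_root_.sesq_mulVec, hA]

theorem Jball_mul_Jball : Jball * Jball = 1 := by
  ext i j; fin_cases i <;> fin_cases j <;> simp [Jball]

theorem det_Jball : Jball.det = -1 := by
  simp [Jball, Matrix.det_diagonal, Fin.prod_univ_three]

theorem InU21.mul {A B : Matrix (Fin 3) (Fin 3) ℂ} (hA : InU21 A) (hB : InU21 B) :
    InU21 (A * B) := by
  unfold InU21 at *
  calc (A * B)ᴴ * Jball * (A * B) = Bᴴ * (Aᴴ * Jball * A) * B := by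
        simp only [conjTranspose_mul, Matrix.mul_assoc]
    _ = Jball := by rw [hA, hB]

/-- Two orthogonal vectors of nonpositive norm are proportional. -/
theorem smul_eq_smul_of_sesq_nonpos {x y : Fin 3 → ℂ} (hx : (sesq Jball x x).re ≤ 0)
    (hy : (sesq Jball y y).re ≤ 0) (hxy : sesq Jball x y = 0) : y 2 • x = x 2 • y := by
  have hyx : sesq Jball y x = 0 := by rw [← star_sesq_Jball, hxy, star_zero]
  have key : sesq Jball (y 2 • x + (-x 2) • y) (y 2 • x + (-x 2) • y) =
      Complex.normSq (y 2) * sesq Jball x x + Complex.normSq (x 2) * sesq Jball y y := by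
    simp only [sesq_add_left, sesq_add_right, sesq_smul_left, sesq_smul_right, hxy, hyx,
      Complex.normSq_eq_conj_mul_self, Complex.star_def, map_neg]
    ring
  have key' := congrArg Complex.re key
  rw [Complex.add_re, Complex.re_ofReal_mul, Complex.re_ofReal_mul, sesq_Jball_self,
    Complex.ofReal_re] at key'
  have h2 : (y 2 • x + (-x 2) • y) 2 = 0 := by simp; ring
  rw [h2, map_zero, sub_zero] at key'
  have hx2 := mul_nonpos_of_nonneg_of_nonpos (Complex.normSq_nonneg (y 2)) hx
  have hy2 := mul_nonpos_of_nonneg_of_nonpos (Complex.normSq_nonneg (x 2)) hy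
  have h0 := Complex.normSq_nonneg ((y 2 • x + (-x 2) • y) 0)
  have h1 := Complex.normSq_nonneg ((y 2 • x + (-x 2) • y) 1)
  have h0' : (y 2 • x + (-x 2) • y) 0 = 0 := Complex.normSq_eq_zero.1 (by linarith)
  have h1' : (y 2 • x + (-x 2) • y) 1 = 0 := Complex.normSq_eq_zero.1 (by linarith)
  have : y 2 • x + (-x 2) • y = 0 := by
    ext i; fin_cases i
    exacts [h0', h1', h2]
  rw [neg_smul] at this
  exact add_neg_eq_zero.1 this

theorem apply_two_ne_zero {x : Fin 3 → ℂ} (hx : x ≠ 0) (h : (sesq Jball x x).re ≤ 0) :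
    x 2 ≠ 0 := by
  intro h2
  rw [sesq_Jball_self, Complex.ofReal_re, h2, map_zero, sub_zero] at h
  have h0 := Complex.normSq_nonneg (x 0)
  have h1 := Complex.normSq_nonneg (x 1)
  apply hx
  have h0' : x 0 = 0 := Complex.normSq_eq_zero.1 (by linarith)
  have h1' : x 1 = 0 := Complex.normSq_eq_zero.1 (by linarith)
  ext i; fin_cases i
  exacts [h0', h1', h2]

/-- The involution fixing the line spanned by `v` and acting as `-1` on its orthogonal. -/
noncomputable def lineReflection (v : Fin 3 → ℂ) : Matrix (Fin 3) (Fin 3) ℂ :=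
  (2 / sesq Jball v v) • vecMulVec v (star v ᵥ* Jball) - 1

theorem lineReflection_mulVec (v x : Fin 3 → ℂ) :
    lineReflection v *ᵥ x = (2 * sesq Jball v x / sesq Jball v v) • v - x := by
  rw [lineReflection, sub_mulVec, one_mulVec, smul_mulVec, vecMulVec_mulVec, ← dotProduct_mulVec]
  ext i
  simp [sesq]
  ring

theorem lineReflection_mul_self {v : Fin 3 → ℂ} (hv : sesq Jball v v ≠ 0) :
    lineReflection v * lineReflection v = 1 := by
  apply Matrix.toLin'.injective
  ext1 i
  ext1
  simp only [LinearMap.comp_apply, toLin'_apply, ← mulVec_mulVec, one_mulVec]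
  generalize (LinearMap.single ℂ (fun _ => ℂ) i) 1 = x
  rw [lineReflection_mulVec v (lineReflection v *ᵥ x), lineReflection_mulVec]
  have : sesq Jball v ((2 * sesq Jball v x / sesq Jball v v) • v - x) = sesq Jball v x := by
    rw [sub_eq_add_neg, ← neg_one_smul ℂ x, sesq_add_right, sesq_smul_right, sesq_smul_right]
    field_simp
    ring
  rw [this]
  abel

theorem lineReflection_inU21 {v : Fin 3 → ℂ} (hv : sesq Jball v v ≠ 0) :
    InU21 (lineReflection v) := by
  refine eq_of_sesq_eq fun x y => ?_
  rw [← sesq_mulVec, lineReflection_mulVec, lineReflection_mulVec, sub_eq_add_neg,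
    sub_eq_add_neg, ← neg_one_smul ℂ x, ← neg_one_smul ℂ y]
  simp only [sesq_add_left, sesq_add_right, sesq_smul_left, sesq_smul_right, star_div₀, star_mul',
    star_sesq_Jball, star_neg, star_one, star_ofNat]
  field_simp
  ring

theorem det_lineReflection {v : Fin 3 → ℂ} (hv : sesq Jball v v ≠ 0) :
    (lineReflection v).det = 1 := by
  rw [lineReflection]
  rw [sesq_Jball] at hv ⊢
  simp [Matrix.det_fin_three, vecMulVec_apply, Jball, vecMul_diagonal] at hv ⊢
  field_simp
  ring

theorem trace_mul_lineReflection (B : Matrix (Fin 3) (Fin 3) ℂ) (v : Fin 3 → ℂ) :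
    (B * lineReflection v).trace = 2 * sesq Jball v (B *ᵥ v) / sesq Jball v v - B.trace := by
  rw [lineReflection, Matrix.mul_sub, Matrix.mul_one, trace_sub, Matrix.mul_smul, trace_smul,
    mul_vecMulVec, trace_vecMulVec, dotProduct_comm, ← dotProduct_mulVec, smul_eq_mul]
  simp only [sesq]
  ring

theorem lineReflection_isInvLift {v : Fin 3 → ℂ} (hv : sesq Jball v v ≠ 0) :
    IsInvLift (lineReflection v) := by
  refine ⟨lineReflection_inU21 hv, lineReflection_mul_self hv, ?_⟩
  have := trace_mul_lineReflection 1 v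
  rw [Matrix.one_mul, one_mulVec, mul_div_cancel_right₀ _ hv] at this
  rw [this]
  norm_num

theorem exists_mulVec_eq_smul {C : Matrix (Fin 3) (Fin 3) ℂ} {r : ℂ}
    (h : (C - r • (1 : Matrix (Fin 3) (Fin 3) ℂ)).det = 0) : ∃ x, x ≠ 0 ∧ C *ᵥ x = r • x := by
  obtain ⟨x, hx, h⟩ := Matrix.exists_mulVec_eq_zero_iff.2 h
  refine ⟨x, hx, ?_⟩
  rwa [sub_mulVec, smul_mulVec, one_mulVec, sub_eq_zero] at h

theorem InU21.mul_eq_one {A : Matrix (Fin 3) (Fin 3) ℂ} (hA : InU21 A) :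
    Jball * Aᴴ * Jball * A = 1 := by
  have h : Aᴴ * Jball * A = Jball := hA
  rw [Matrix.mul_assoc, Matrix.mul_assoc, ← Matrix.mul_assoc Aᴴ, h, Jball_mul_Jball]

theorem InU21.trace_adjugate {C : Matrix (Fin 3) (Fin 3) ℂ} (hC : InU21 C) (hdet : C.det = 1) :
    C.adjugate.trace = star C.trace := by
  have h1 : C.adjugate = Jball * Cᴴ * Jball := by
    have h := hC.mul_eq_one
    calc C.adjugate = (Jball * Cᴴ * Jball * C) * C.adjugate := by rw [h, Matrix.one_mul]
      _ = _ := by rw [Matrix.mul_assoc _ C, mul_adjugate, hdet, one_smul, Matrix.mul_one]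
  rw [h1, trace_mul_comm, ← Matrix.mul_assoc, Jball_mul_Jball, Matrix.one_mul,
    trace_conjTranspose]

theorem det_sub_smul_one (C : Matrix (Fin 3) (Fin 3) ℂ) (r : ℂ) :
    (C - r • (1 : Matrix (Fin 3) (Fin 3) ℂ)).det =
      C.det - r * C.adjugate.trace + r ^ 2 * C.trace - r ^ 3 := by
  simp [Matrix.det_fin_three, Matrix.adjugate_fin_three, Matrix.trace_fin_three]
  ring

/-- An element of `SU(2,1)` with real trace less than `-1` is a product of two involutions. -/
theorem exists_mul_isInvLift {C : Matrix (Fin 3) (Fin 3) ℂ} (hC : InU21 C) (hdet : C.det = 1)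
    {T : ℝ} (hT : T < -1) (htr : C.trace = T) :
    ∃ I₁ I₂, IsInvLift I₁ ∧ IsInvLift I₂ ∧ C = I₁ * I₂ := by
  obtain ⟨r, hr⟩ : ∃ r : ℝ, r ^ 2 - (T - 1) * r + 1 = 0 := by
    have hd : 0 ≤ (T - 1) ^ 2 - 4 := by nlinarith
    refine ⟨((T - 1) + √((T - 1) ^ 2 - 4)) / 2, ?_⟩
    have := Real.sq_sqrt hd
    nlinarith
  have hr0 : r ≠ 0 := by rintro rfl; norm_num at hr
  have hr1 : r ≠ 1 := by rintro rfl; linarith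
  have hr2 : r ^ 2 ≠ 1 := by
    intro h
    have h2 : (T - 1) * r = 2 := by linarith
    have h3 : ((T - 1) * r) ^ 2 = 4 := by rw [h2]; norm_num
    rw [mul_pow, h] at h3
    nlinarith
  have hroot : ∀ s : ℝ, (s - 1) * (s ^ 2 - (T - 1) * s + 1) = 0 →
      ∃ x, x ≠ 0 ∧ C *ᵥ x = (s : ℂ) • x := by
    intro s hs
    apply exists_mulVec_eq_smul
    rw [det_sub_smul_one, hC.trace_adjugate hdet, hdet, htr, Complex.star_def,
      Complex.conj_ofReal]
    norm_cast
    linear_combination -hs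
  obtain ⟨x, hx0, hx⟩ := hroot r (by rw [hr, mul_zero])
  obtain ⟨y, hy0, hy⟩ := hroot r⁻¹ (by
    rw [show r⁻¹ ^ 2 - (T - 1) * r⁻¹ + 1 = (r ^ 2 - (T - 1) * r + 1) * (r⁻¹) ^ 2 by
      field_simp; ring, hr, zero_mul, mul_zero])
  obtain ⟨p, hp0, hp⟩ := hroot 1 (by ring)
  have orth : ∀ {a b : Fin 3 → ℂ} {s t : ℝ}, C *ᵥ a = (s : ℂ) • a → C *ᵥ b = (t : ℂ) • b →
      s * t ≠ 1 → sesq Jball a b = 0 := by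
    intro a b s t ha hb hst
    have h := hC.sesq_mulVec a b
    rw [ha, hb, sesq_smul_left, sesq_smul_right, Complex.star_def, Complex.conj_ofReal] at h
    have h' : ((s * t - 1 : ℝ) : ℂ) * sesq Jball a b = 0 := by push_cast; linear_combination h
    exact (mul_eq_zero.1 h').resolve_left (Complex.ofReal_ne_zero.2 (sub_ne_zero.2 hst))
  have hxx : sesq Jball x x = 0 := orth hx hx (by rwa [← sq])
  have hyy : sesq Jball y y = 0 := orth hy hy (by rw [← sq, inv_pow]; simpa using hr2)
  have hpx : sesq Jball p x = 0 := orth hp hx (by rwa [one_mul])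
  have hpy : sesq Jball p y = 0 := orth hp hy (by rw [one_mul]; simpa using hr1)
  have hxy : sesq Jball x y ≠ 0 := by
    intro h
    have h2 := smul_eq_smul_of_sesq_nonpos (by simp [hxx]) (by simp [hyy]) h
    have hx2 := apply_two_ne_zero hx0 (by simp [hxx])
    have hC2 := congrArg (C *ᵥ ·) h2
    simp only [mulVec_smul, hx, hy] at hC2
    have e1 := congrFun hC2 2
    simp only [Pi.smul_apply, smul_eq_mul] at e1
    have hy2 := apply_two_ne_zero hy0 (by simp [hyy])
    have : (r : ℂ) = (r⁻¹ : ℝ) := by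
      have h3 : x 2 * y 2 ≠ 0 := mul_ne_zero hx2 hy2
      apply mul_left_cancel₀ h3
      linear_combination e1
    have h4 : r = r⁻¹ := by exact_mod_cast this
    apply hr2
    rw [sq]
    nth_rewrite 1 [h4]
    exact inv_mul_cancel₀ hr0
  obtain ⟨z, hz, hxz, hzz, hpz⟩ : ∃ z, C *ᵥ z = ((r⁻¹ : ℝ) : ℂ) • z ∧ sesq Jball x z = 1 ∧
      sesq Jball z z = 0 ∧ sesq Jball p z = 0 := by
    refine ⟨(sesq Jball x y)⁻¹ • y, ?_, ?_, ?_, ?_⟩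
    · rw [mulVec_smul, hy, smul_comm]
    · rw [sesq_smul_right, inv_mul_cancel₀ hxy]
    · rw [sesq_smul_right, sesq_smul_left, hyy, mul_zero, mul_zero]
    · rw [sesq_smul_right, hpy, mul_zero]
  have hzx : sesq Jball z x = 1 := by rw [← star_sesq_Jball, hxz, star_one]
  have hrc : (r : ℂ) ≠ 0 := Complex.ofReal_ne_zero.2 hr0
  have hww : sesq Jball (x + z) (x + z) = 2 := by
    simp only [sesq_add_left, sesq_add_right, hxx, hxz, hzz, hzx]; norm_num
  have hw0 : sesq Jball (x + z) (x + z) ≠ 0 := by rw [hww]; norm_num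
  have hL := lineReflection_isInvLift hw0
  have hLx : lineReflection (x + z) *ᵥ x = z := by
    rw [lineReflection_mulVec, hww, sesq_add_left, hxx, hzx]; norm_num
  have hLz : lineReflection (x + z) *ᵥ z = x := by
    rw [lineReflection_mulVec, hww, sesq_add_left, hxz, hzz]; norm_num
  have hLp : lineReflection (x + z) *ᵥ p = -p := by
    rw [lineReflection_mulVec, sesq_add_left, ← star_sesq_Jball, hpx, ← star_sesq_Jball, hpz]
    simp
  refine ⟨C * lineReflection (x + z), lineReflection (x + z),
    ⟨hC.mul hL.1, ?_, ?_⟩, hL, ?_⟩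
  · set X := C * lineReflection (x + z) with hX
    have hXx : X *ᵥ x = ((r⁻¹ : ℝ) : ℂ) • z := by rw [hX, ← mulVec_mulVec, hLx, hz]
    have hXz : X *ᵥ z = (r : ℂ) • x := by rw [hX, ← mulVec_mulVec, hLz, hx]
    have hXp : X *ᵥ p = -p := by
      rw [hX, ← mulVec_mulVec, hLp, mulVec_neg, hp, Complex.ofReal_one, one_smul]
    have hP : IsUnit (Matrix.of ![x, z, p])ᵀ := by
      rw [Matrix.isUnit_iff_isUnit_det, isUnit_iff_ne_zero]
      intro h0
      obtain ⟨a, ha0, ha⟩ := Matrix.exists_mulVec_eq_zero_iff.2 h0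
      have ha' : a 0 • x + a 1 • z + a 2 • p = 0 := by
        rw [← ha]
        ext i
        fin_cases i <;> simp [Matrix.mulVec, dotProduct, Fin.sum_univ_three] <;> ring
      have c0 := congrArg (sesq Jball z) ha'
      have c1 := congrArg (sesq Jball x) ha'
      have hxp : sesq Jball x p = 0 := by rw [← star_sesq_Jball, hpx, star_zero]
      have hzp : sesq Jball z p = 0 := by rw [← star_sesq_Jball, hpz, star_zero]
      simp only [sesq_add_right, sesq_smul_right, hzx, hzz, hzp, hxx, hxz, hxp,
        sesq_zero_right] at c0 c1
      have c0' : a 0 = 0 := by linear_combination c0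
      have c1' : a 1 = 0 := by linear_combination c1
      rw [c0', c1', zero_smul, zero_smul, zero_add, zero_add] at ha'
      have c2' : a 2 = 0 := (smul_eq_zero.1 ha').resolve_right hp0
      apply ha0
      ext i; fin_cases i
      exacts [c0', c1', c2']
    refine hP.mul_right_cancel ?_
    rw [Matrix.one_mul]
    have e0 : (X * X) *ᵥ x = x := by
      rw [← mulVec_mulVec, hXx, mulVec_smul, hXz, smul_smul]; simp [hrc]
    have e1 : (X * X) *ᵥ z = z := by
      rw [← mulVec_mulVec, hXz, mulVec_smul, hXx, smul_smul]; simp [hrc]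
    have e2 : (X * X) *ᵥ p = p := by
      rw [← mulVec_mulVec, hXp, mulVec_neg, hXp, neg_neg]
    ext i j
    fin_cases j
    exacts [congrFun e0 i, congrFun e1 i, congrFun e2 i]
  · rw [trace_mul_lineReflection, hww, mulVec_add, hx, hz, htr]
    simp only [sesq_add_left, sesq_add_right, sesq_smul_right, hxx, hxz, hzz, hzx]
    have hr' : (r : ℂ) ^ 2 - (T - 1) * r + 1 = 0 := by exact_mod_cast hr
    push_cast
    field_simp
    linear_combination hr'
  · rw [Matrix.mul_assoc, lineReflection_mul_self hw0, Matrix.mul_one]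

/-- `A` is, up to scaling, the square of a special unitary `B` (for the form `G`) whose product
with the reflection in a suitable vector `v` has real trace `T < -1`. -/
def HasHyperbolicRoot (G A : Matrix (Fin 3) (Fin 3) ℂ) : Prop :=
  ∃ (B : Matrix (Fin 3) (Fin 3) ℂ) (v : Fin 3 → ℂ) (c : ℂ) (T : ℝ),
    c ≠ 0 ∧ Bᴴ * G * B = G ∧ B.det = 1 ∧ A = c • B ^ 2 ∧ T < -1 ∧ sesq G v v ≠ 0 ∧
      2 * sesq G v (B *ᵥ v) = (T + B.trace) * sesq G v v

theorem HasHyperbolicRoot.exists_isInvLift {A : Matrix (Fin 3) (Fin 3) ℂ}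
    (h : HasHyperbolicRoot Jball A) :
    ∃ (I₁ I₂ I₃ : Matrix (Fin 3) (Fin 3) ℂ) (c : ℂ),
      c ≠ 0 ∧ IsInvLift I₁ ∧ IsInvLift I₂ ∧ IsInvLift I₃ ∧
      A = c • (I₁ * I₂ * I₃) ^ 2 := by
  obtain ⟨B, v, c, T, hc, hB, hdet, hA, hT, hv, hvT⟩ := h
  have hL := lineReflection_isInvLift hv
  obtain ⟨I₁, I₂, h₁, h₂, h⟩ := exists_mul_isInvLift (C := B * lineReflection v) (T := T)
    (InU21.mul hB hL.1) (by rw [det_mul, hdet, det_lineReflection hv, one_mul]) hT (by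
      rw [trace_mul_lineReflection, hvT, mul_div_cancel_right₀ _ hv]; ring)
  refine ⟨I₁, I₂, lineReflection v, c, hc, h₁, h₂, hL, ?_⟩
  rw [← h, Matrix.mul_assoc, lineReflection_mul_self hv, Matrix.mul_one, hA]

theorem HasHyperbolicRoot.of_conj {G G' A A' P : Matrix (Fin 3) (Fin 3) ℂ} (hP : IsUnit P.det)
    (hG : Pᴴ * G * P = G') (hA : A * P = P * A') (h : HasHyperbolicRoot G' A') :
    HasHyperbolicRoot G A := by
  obtain ⟨B, v, c, T, hc, hB, hdet, hA', hT, hv, hvT⟩ := h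
  have hPi : P⁻¹ * P = 1 := nonsing_inv_mul P hP
  have hiP : P * P⁻¹ = 1 := mul_nonsing_inv P hP
  have hPB : P * B * P⁻¹ * P = P * B := by rw [Matrix.mul_assoc, hPi, Matrix.mul_one]
  have hG' : ∀ x y, sesq G (P *ᵥ x) (P *ᵥ y) = sesq G' x y := fun x y => by
    rw [sesq_mulVec, hG]
  refine ⟨P * B * P⁻¹, P *ᵥ v, c, T, hc, ?_, ?_, ?_, hT, ?_, ?_⟩
  · have hu : IsUnit P := (Matrix.isUnit_iff_isUnit_det P).2 hP
    refine hu.mul_right_cancel (hu.star.mul_left_cancel ?_)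
    rw [star_eq_conjTranspose]
    calc Pᴴ * ((P * B * P⁻¹)ᴴ * G * (P * B * P⁻¹) * P)
        = (P * B * P⁻¹ * P)ᴴ * G * (P * B * P⁻¹ * P) := by
          simp only [conjTranspose_mul, Matrix.mul_assoc]
      _ = Bᴴ * (Pᴴ * G * P) * B := by
          rw [hPB]; simp only [conjTranspose_mul, Matrix.mul_assoc]
      _ = Pᴴ * (G * P) := by rw [hG, hB, ← hG, Matrix.mul_assoc]
  · rw [det_mul, det_mul, mul_right_comm, ← det_mul, hiP, det_one, one_mul, hdet]
  · calc A = A * P * P⁻¹ := by rw [Matrix.mul_assoc, hiP, Matrix.mul_one]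
      _ = c • (P * B * (P⁻¹ * P) * B * P⁻¹) := by
        rw [hA, hA', hPi]; simp only [sq, Matrix.mul_smul, Matrix.smul_mul, Matrix.mul_assoc,
          Matrix.mul_one]
      _ = _ := by simp only [sq, Matrix.mul_assoc]
  · rwa [hG']
  · rw [mulVec_mulVec, hPB, ← mulVec_mulVec, hG', hG', trace_mul_cycle, hPi, Matrix.one_mul, hvT]

theorem HasHyperbolicRoot.smul {G A : Matrix (Fin 3) (Fin 3) ℂ} (h : HasHyperbolicRoot G A)
    {k : ℂ} (hk : k ≠ 0) : HasHyperbolicRoot G (k • A) := by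
  obtain ⟨B, v, c, T, hc, hB, hdet, hA, h⟩ := h
  exact ⟨B, v, k * c, T, mul_ne_zero hk hc, hB, hdet, by rw [hA, smul_smul], h⟩

/-- The Hermitian form of signature (2,1) on `ℂ³` in the Siegel model. -/
def siegelForm : Matrix (Fin 3) (Fin 3) ℂ := !![0, 0, 1; 0, 1, 0; 1, 0, 0]

theorem sesq_siegelForm (x y : Fin 3 → ℂ) :
    sesq siegelForm x y = star (x 0) * y 2 + star (x 1) * y 1 + star (x 2) * y 0 := by
  simp [sesq, siegelForm, dotProduct, Fin.sum_univ_three, Matrix.mulVec]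

theorem hasHyperbolicRoot_sq_unipotent {b c : ℂ} (hb : b ≠ 0)
    (hc : c + star c = -(b * star b)) :
    HasHyperbolicRoot siegelForm (!![1, b, c; 0, 1, -star b; 0, 0, 1] ^ 2) := by
  have hb' : star b ≠ 0 := star_ne_zero.2 hb
  have hc' : star c = -(b * star b) - c := by rw [← hc]; ring
  set y : ℂ := -(c - star c) / (4 * b) with hy
  have hsy : star y = (c - star c) / (4 * star b) := by
    rw [hy]
    simp only [star_div₀, star_neg, star_sub, star_star, star_mul', star_ofNat]
    ring
  set x : ℂ := -(y * star y) / 2 + b * star b / 2 with hx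
  have hsx : star x = x := by
    rw [hx]
    simp only [star_add, star_div₀, star_neg, star_star, star_mul', star_ofNat]
    ring
  have hby : b * y = -(c - star c) / 4 := by rw [hy]; field_simp
  have hbsy : star b * star y = (c - star c) / 4 := by rw [hsy]; field_simp
  refine ⟨!![1, b, c; 0, 1, -star b; 0, 0, 1], ![x, y, 1], 1, -2, one_ne_zero, ?_, ?_,
    (one_smul _ _).symm, by norm_num, ?_, ?_⟩
  · ext i j
    fin_cases i <;> fin_cases j <;>
      simp [siegelForm, Matrix.mul_apply, Fin.sum_univ_three]
    all_goals
      simp only [← Complex.star_def, hc']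
      ring
  · simp [Matrix.det_fin_three]
  · have : sesq siegelForm ![x, y, 1] ![x, y, 1] = b * star b := by
      simp only [sesq_siegelForm, cons_val_zero, cons_val_one, cons_val, hsx, star_one]
      rw [hx]; ring
    rw [this]
    exact mul_ne_zero hb hb'
  · simp [sesq_siegelForm, Matrix.trace_fin_three]
    simp only [← Complex.star_def, hsx]
    rw [hx]
    linear_combination 2 * hby - 2 * hbsy + hc

theorem hasHyperbolicRoot_unipotent {b c : ℂ} (hb : b ≠ 0) (hc : c + star c = -(b * star b)) :
    HasHyperbolicRoot siegelForm !![1, b, c; 0, 1, -star b; 0, 0, 1] := by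
  have h := hasHyperbolicRoot_sq_unipotent (b := b / 2) (c := c / 2 + b * star b / 8)
    (div_ne_zero hb two_ne_zero) (by
      simp only [star_add, star_div₀, star_star, star_mul', star_ofNat]
      linear_combination hc / 2)
  convert h using 1
  ext i j
  fin_cases i <;> fin_cases j <;> simp [sq, Matrix.mul_apply, Fin.sum_univ_three] <;> ring

theorem hasHyperbolicRoot_ellipto_parabolic {C S t : ℝ} (h1 : C ^ 2 + S ^ 2 = 1) (hC : 0 < C)
    (hSt : 0 < S * t) :
    HasHyperbolicRoot siegelForm
      !![1, 0, 2 * t * Complex.I; 0, star (⟨C, S⟩ : ℂ) ^ 6, 0; 0, 0, 1] := by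
  have hS : 0 < S ^ 2 := by
    have : S ≠ 0 := by rintro rfl; simp at hSt
    positivity
  have ht : t ≠ 0 := by rintro rfl; simp at hSt
  have hC1 : C < 1 := by nlinarith
  set c₃ := 4 * C ^ 3 - 3 * C with hc₃
  have hc₃1 : c₃ < 1 := by
    have : c₃ - 1 = (C - 1) * (2 * C + 1) ^ 2 := by rw [hc₃]; ring
    nlinarith [sq_nonneg (2 * C + 1), mul_pos (sub_pos.2 hC1) (by positivity : 0 < (2 * C + 1) ^ 2)]
  have hc₃2 : -1 ≤ c₃ := by
    have : c₃ + 1 = (C + 1) * (2 * C - 1) ^ 2 := by rw [hc₃]; ring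
    have : 0 ≤ (C + 1) * (2 * C - 1) ^ 2 := by positivity
    linarith
  obtain ⟨κ, hκ⟩ : ∃ κ, κ * (1 - c₃) = 5 := ⟨5 / (1 - c₃), div_mul_cancel₀ _ (by linarith)⟩
  have hκ1 : 1 ≤ κ := by nlinarith
  obtain ⟨σ, hσ0, hσ⟩ : ∃ σ, 0 < σ ∧ t * σ * C = S * (κ * (2 * C + 1) - 2 * C) := by
    refine ⟨S * t * (κ * (2 * C + 1) - 2 * C) / (t ^ 2 * C), ?_, by field_simp⟩
    have : 0 < κ * (2 * C + 1) - 2 * C := by nlinarith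
    positivity
  obtain ⟨T, hT⟩ : ∃ T, T * C = -c₃ - 5 := ⟨(-c₃ - 5) / C, div_mul_cancel₀ _ hC.ne'⟩
  have hre : T = -S * (t * σ) + (C ^ 2 - S ^ 2 - C) * κ - (C ^ 2 - S ^ 2) := by
    apply mul_right_cancel₀ hC.ne'
    have hS' : S ^ 2 = 1 - C ^ 2 := by linarith
    rw [hT]
    linear_combination S * hσ + hκ - hc₃ * (κ-1) + (κ * (3 * C + 1)- 3 * C ) * hS'
  have hu : star (⟨C, S⟩ : ℂ) * ⟨C, S⟩ = 1 := by
    apply Complex.ext <;> simp <;> linarith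
  have hu0 : (⟨C, S⟩ : ℂ) ≠ 0 := by
    rintro h
    rw [h] at hu
    simp at hu
  set u : ℂ := ⟨C, S⟩ with huu
  obtain ⟨s, hs⟩ : ∃ s, s * σ = 1 := ⟨σ⁻¹, inv_mul_cancel₀ hσ0.ne'⟩
  have hs0 : 0 < s := by
    by_contra h
    nlinarith
  have hk : √(κ * s) ^ 2 = κ * s := Real.sq_sqrt (by positivity)
  have hvv : sesq siegelForm ![((-(κ * s) / 2 + s : ℝ) : ℂ), (√(κ * s) : ℝ), 1]
      ![((-(κ * s) / 2 + s : ℝ) : ℂ), (√(κ * s) : ℝ), 1] = ((2 * s : ℝ) : ℂ) := by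
    simp only [sesq_siegelForm, cons_val_zero, cons_val_one, cons_val, Complex.star_def,
      Complex.conj_ofReal, star_one]
    norm_cast
    linear_combination hk
  refine ⟨!![u, 0, u * (t * Complex.I); 0, star u ^ 2, 0; 0, 0, u],
    ![((-(κ * s) / 2 + s : ℝ) : ℂ), (√(κ * s) : ℝ), 1], star u ^ 2, T,
    pow_ne_zero _ (star_ne_zero.2 hu0), ?_, ?_, ?_, ?_, ?_, ?_⟩
  · ext i j
    fin_cases i <;> fin_cases j <;>
      simp [siegelForm, Matrix.mul_apply, Fin.sum_univ_three] <;>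
      simp only [← Complex.star_def] <;>
      first | linear_combination hu | linear_combination (star u * u + 1) * hu | ring
  · simp [Matrix.det_fin_three]
    simp only [← Complex.star_def]
    linear_combination (star u * u + 1) * hu
  · ext i j
    fin_cases i <;> fin_cases j <;>
      simp [sq] <;>
      simp only [← Complex.star_def] <;>
      first
      | linear_combination -(star u * u + 1) * hu
      | linear_combination -2 * t * Complex.I * (star u * u + 1) * hu
      | ring
  · nlinarith
  · rw [hvv]
    exact Complex.ofReal_ne_zero.2 (by positivity)
  · rw [hvv]
    simp only [sesq_siegelForm, cons_val_zero, cons_val_one, cons_val, Complex.star_def,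
      Complex.conj_ofReal, star_one, Matrix.mulVec, dotProduct, Fin.sum_univ_three,
      Matrix.trace_fin_three, Matrix.of_apply]
    apply Complex.ext
    · simp [huu, sq]
      linear_combination -2 * s * hre + 2 * (C ^ 2 - S ^ 2) * hk + 2 * S * t * hs
    · simp [huu, sq]
      linear_combination 2 * s * hσ - 4 * C * S * hk - 2 * C * t * hs

theorem hasHyperbolicRoot_loxodromic {C S ρ : ℝ} (h1 : C ^ 2 + S ^ 2 = 1) (hC : 0 < C)
    (hρ : 0 < ρ) (hρ1 : ρ ≠ 1) :
    HasHyperbolicRoot siegelForm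
      (diagonal ![(ρ : ℂ) * (⟨C, S⟩ : ℂ), star (⟨C, S⟩ : ℂ) ^ 2,
        ((ρ⁻¹ : ℝ) : ℂ) * (⟨C, S⟩ : ℂ)] ^ 2) := by
  have hC1 : C ≤ 1 := by nlinarith
  have hρi : ρ * ρ⁻¹ = 1 := mul_inv_cancel₀ hρ.ne'
  have hi : 0 < ρ⁻¹ := inv_pos.2 hρ
  set τ := ρ⁻¹ with hτ
  have hne : ρ - τ ≠ 0 := by
    intro h
    have : τ = ρ := by linarith
    rw [this] at hρi
    exact hρ1 (by nlinarith)
  have hR : 2 < ρ + τ := by nlinarith [sq_pos_of_ne_zero hne]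
  set c₃ := 4 * C ^ 3 - 3 * C with hc₃
  have hc₃1 : c₃ ≤ 1 := by
    have : c₃ - 1 = (C - 1) * (2 * C + 1) ^ 2 := by rw [hc₃]; ring
    nlinarith [mul_nonneg (sub_nonneg.2 hC1) (sq_nonneg (2 * C + 1))]
  have hc₃2 : -1 ≤ c₃ := by
    have : c₃ + 1 = (C + 1) * (2 * C - 1) ^ 2 := by rw [hc₃]; ring
    have : 0 ≤ (C + 1) * (2 * C - 1) ^ 2 := by positivity
    linarith
  obtain ⟨k, hk0, hk⟩ : ∃ k, 0 ≤ k ∧ k * (ρ + τ - 2 * c₃) = 6 :=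
    ⟨6 / (ρ + τ - 2 * c₃), div_nonneg (by norm_num) (by linarith),
      div_mul_cancel₀ _ (by linarith)⟩
  obtain ⟨T, hT⟩ : ∃ T, T * C = -c₃ - 6 := ⟨(-c₃ - 6) / C, div_mul_cancel₀ _ hC.ne'⟩
  obtain ⟨w, hw⟩ : ∃ w, w * C = S * ((ρ + τ) * k + 2 * C * (2 * k - 1)) :=
    ⟨S * ((ρ + τ) * k + 2 * C * (2 * k - 1)) / C, div_mul_cancel₀ _ hC.ne'⟩
  obtain ⟨t, ht⟩ : ∃ t, t * (ρ - τ) = w / 2 := ⟨w / 2 / (ρ - τ), div_mul_cancel₀ _ hne⟩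
  have hre : T = -C * (ρ + τ) * k - S * w + (C ^ 2 - S ^ 2) * (2 * k - 1) := by
    apply mul_right_cancel₀ hC.ne'
    have hS' : S ^ 2 = 1 - C ^ 2 := by linarith
    rw [hT]
    linear_combination S * hw + hk + hc₃ * (2 * k - 1) +
      (k * (ρ + τ) + 3 * C * (2 * k - 1)) * hS'
  have hu : star (⟨C, S⟩ : ℂ) * ⟨C, S⟩ = 1 := by
    apply Complex.ext <;> simp <;> linarith
  set u : ℂ := ⟨C, S⟩ with huu
  have hρc : (ρ : ℂ) * τ = 1 := by exact_mod_cast hρi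
  have hks : √k ^ 2 = k := Real.sq_sqrt hk0
  have hvv : sesq siegelForm ![⟨(1 - k) / 2, t⟩, (√k : ℝ), 1] ![⟨(1 - k) / 2, t⟩, (√k : ℝ), 1]
      = 1 := by
    simp only [sesq_siegelForm, cons_val_zero, cons_val_one, cons_val, Complex.star_def,
      Complex.conj_ofReal, star_one]
    apply Complex.ext
    · simp
      linear_combination hks
    · simp
  refine ⟨diagonal ![ρ * u, star u ^ 2, τ * u], ![⟨(1 - k) / 2, t⟩, (√k : ℝ), 1], 1, T,
    one_ne_zero, ?_, ?_, (one_smul _ _).symm, ?_, ?_, ?_⟩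
  · ext i j
    fin_cases i <;> fin_cases j <;>
      simp [siegelForm, Matrix.mul_apply, Matrix.diagonal_apply] <;>
      simp only [← Complex.star_def] <;>
      first | linear_combination (star u * u + 1) * hu | linear_combination hu + star u * u * hρc
  · simp [Fin.prod_univ_three]
    simp only [← Complex.star_def]
    linear_combination (star u * u + 1) * hu + (star u * u) ^ 2 * hρc
  · nlinarith
  · rw [hvv]
    exact one_ne_zero
  · rw [hvv]
    simp only [sesq_siegelForm, cons_val_zero, cons_val_one, cons_val, Complex.star_def,
      Complex.conj_ofReal, star_one, mulVec_diagonal, Matrix.trace_diagonal, Fin.sum_univ_three]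
    apply Complex.ext
    · simp [huu, sq]
      linear_combination -hre + 2 * (C ^ 2 - S ^ 2) * hks - 2 * S * ht
    · simp [huu, sq]
      linear_combination hw - 4 * C * S * hks + 2 * C * ht

theorem hasHyperbolicRoot_elliptic {p q : ℝ} (hp : 0 < p) (hpq : p < q) (hq : q < Real.pi)
    (h1 : Real.pi / 2 < 2 * q - p) (h2 : 2 * p - q < Real.pi / 2) :
    HasHyperbolicRoot Jball (diagonal ![Complex.exp ((4 * p : ℝ) * Complex.I),
      Complex.exp ((4 * q : ℝ) * Complex.I), 1]) := by
  obtain ⟨g, hg⟩ : ∃ g : ℝ, g = 2 * Real.pi / 3 - 2 / 3 * (p + q) := ⟨_, rfl⟩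
  have hsp : 0 < Real.sin p := Real.sin_pos_of_pos_of_lt_pi hp (by linarith)
  have hsq : 0 < Real.sin q := Real.sin_pos_of_pos_of_lt_pi (by linarith) hq
  have hspq : 0 < Real.sin (q - p) := Real.sin_pos_of_pos_of_lt_pi (by linarith) (by linarith)
  have hcp : 0 < Real.cos (g + p) :=
    Real.cos_pos_of_mem_Ioo ⟨by linarith, by linarith⟩
  have hcq : Real.cos (g + q) < 0 :=
    Real.cos_neg_of_pi_div_two_lt_of_lt (by linarith) (by linarith)
  have hcp1 := Real.cos_le_one (g + p)
  obtain ⟨Y, hY1, hY2, hY3⟩ : ∃ Y, 3 ≤ Y * -Real.cos (g + q) ∧ 2 ≤ Y * Real.sin (q - p) ∧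
      2 ≤ Y := by
    have hcq' : 0 < -Real.cos (g + q) := by linarith
    refine ⟨3 / -Real.cos (g + q) + 2 / Real.sin (q - p) + 2, ?_, ?_, ?_⟩
    · have : 0 < (2 / Real.sin (q - p) + 2) * -Real.cos (g + q) := by positivity
      have h3 := div_mul_cancel₀ 3 hcq'.ne'
      linarith
    · have : 0 < (3 / -Real.cos (g + q) + 2) * Real.sin (q - p) := by positivity
      have h3 := div_mul_cancel₀ 2 hspq.ne'
      linarith
    · have : 0 < 3 / -Real.cos (g + q) + 2 / Real.sin (q - p) := by positivity
      linarith
  obtain ⟨X, hX⟩ : ∃ X, X * Real.cos (g + p) = -(Real.sin g - Real.sin (g + 2 * p) -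
      Real.sin (g + 2 * q)) / 2 - Y * Real.cos (g + q) := ⟨_, div_mul_cancel₀ _ hcp.ne'⟩
  have hX0 : 0 ≤ X := by
    have e1 := Real.sin_le_one g
    have e2 := Real.neg_one_le_sin (g + 2 * p)
    have e3 := Real.neg_one_le_sin (g + 2 * q)
    have : 0 ≤ X * Real.cos (g + p) := by rw [hX]; linarith
    exact nonneg_of_mul_nonneg_left this hcp
  obtain ⟨T, hT⟩ : ∃ T, T = Real.cos g - Real.cos (g + 2 * p) - Real.cos (g + 2 * q) -
      2 * (X * Real.sin (g + p) + Y * Real.sin (g + q)) := ⟨_, rfl⟩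
  have hcg : Real.cos g =
      Real.cos (g + p) * Real.cos p + Real.sin (g + p) * Real.sin p := by
    rw [← Real.cos_sub]; congr 1; ring
  have hsg : Real.sin g =
      Real.sin (g + p) * Real.cos p - Real.cos (g + p) * Real.sin p := by
    rw [← Real.sin_sub]; congr 1; ring
  have hc2p : Real.cos (g + 2 * p) =
      Real.cos (g + p) * Real.cos p - Real.sin (g + p) * Real.sin p := by
    rw [← Real.cos_add]; congr 1; ring
  have hs2p : Real.sin (g + 2 * p) =
      Real.sin (g + p) * Real.cos p + Real.cos (g + p) * Real.sin p := by
    rw [← Real.sin_add]; congr 1; ring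
  have hTC : T * Real.cos (g + p) = -Real.cos (2 * q - p) - 2 * Y * Real.sin (q - p) := by
    have a1 : Real.cos (2 * q - p) = Real.cos (g + 2 * q) * Real.cos (g + p) +
        Real.sin (g + 2 * q) * Real.sin (g + p) := by
      rw [← Real.cos_sub]; congr 1; ring
    have a2 : Real.sin (q - p) = Real.sin (g + q) * Real.cos (g + p) -
        Real.cos (g + q) * Real.sin (g + p) := by
      rw [← Real.sin_sub]; congr 1; ring
    rw [hT, a1, a2]
    linear_combination -2 * Real.sin (g + p) * hX + Real.cos (g + p) * (hcg - hc2p) +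
      Real.sin (g + p) * (hsg - hs2p)
  have hT1 : T < -1 := by
    have := Real.neg_one_le_cos (2 * q - p)
    nlinarith
  obtain ⟨x, hx⟩ : ∃ x, x * (2 * Real.sin p) = X := ⟨_, div_mul_cancel₀ _ (by positivity)⟩
  obtain ⟨y, hy⟩ : ∃ y, y * (2 * Real.sin q) = Y := ⟨_, div_mul_cancel₀ _ (by positivity)⟩
  have hx0 : 0 ≤ x := nonneg_of_mul_nonneg_left (by rwa [hx]) (by positivity)
  have hy1 : 1 ≤ y := by
    have := Real.sin_le_one q
    by_contra h
    nlinarith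
  have hxs := Real.sq_sqrt hx0
  have hys := Real.sq_sqrt (zero_le_one.trans hy1)
  have hzs := Real.sq_sqrt (show 0 ≤ x + y - 1 by linarith)
  have hexp : ∀ θ : ℝ, star (Complex.exp (θ * Complex.I)) * Complex.exp (θ * Complex.I) = 1 := by
    intro θ
    rw [Complex.star_def, ← Complex.exp_conj, ← Complex.exp_add]
    simp
  have hvv : sesq Jball ![(√x : ℝ), (√y : ℝ), (√(x + y - 1) : ℝ)]
      ![(√x : ℝ), (√y : ℝ), (√(x + y - 1) : ℝ)] = 1 := by
    simp only [sesq_Jball, cons_val_zero, cons_val_one, cons_val, Complex.star_def,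
      Complex.conj_ofReal]
    norm_cast
    linear_combination hxs + hys - hzs
  refine ⟨diagonal ![Complex.exp ((g + 2 * p : ℝ) * Complex.I),
    Complex.exp ((g + 2 * q : ℝ) * Complex.I), Complex.exp (g * Complex.I)],
    ![(√x : ℝ), (√y : ℝ), (√(x + y - 1) : ℝ)], Complex.exp ((-2 * g : ℝ) * Complex.I), T,
    Complex.exp_ne_zero _, ?_, ?_, ?_, hT1, ?_, ?_⟩
  · have hp' := hexp (g + 2 * p)
    have hq' := hexp (g + 2 * q)
    have hg' := hexp g
    ext i j
    fin_cases i <;> fin_cases j <;>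
      simp [Jball, -Complex.ofReal_add, -Complex.ofReal_mul] <;>
      simp only [← Complex.star_def] <;> assumption
  · simp only [det_diagonal, Fin.prod_univ_three, cons_val_zero, cons_val_one, cons_val]
    rw [← Complex.exp_add, ← Complex.exp_add, Complex.exp_eq_one_iff]
    refine ⟨1, ?_⟩
    rw [hg]
    push_cast
    ring
  · rw [sq, diagonal_mul_diagonal, ← diagonal_smul]
    congr 1
    ext i
    fin_cases i <;>
      simp only [Pi.smul_apply, smul_eq_mul, ← Complex.exp_add, Fin.zero_eta, Fin.mk_one,
        Fin.reduceFinMk, cons_val_zero, cons_val_one, cons_val]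
    · congr 1; push_cast; ring
    · congr 1; push_cast; ring
    · rw [eq_comm, Complex.exp_eq_one_iff]; exact ⟨0, by push_cast; ring⟩
  · rw [hvv]
    exact one_ne_zero
  · have hcg' : Real.cos g =
        Real.cos (g + q) * Real.cos q + Real.sin (g + q) * Real.sin q := by
      rw [← Real.cos_sub]; congr 1; ring
    have hsg' : Real.sin g =
        Real.sin (g + q) * Real.cos q - Real.cos (g + q) * Real.sin q := by
      rw [← Real.sin_sub]; congr 1; ring
    have hc2q : Real.cos (g + 2 * q) =
        Real.cos (g + q) * Real.cos q - Real.sin (g + q) * Real.sin q := by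
      rw [← Real.cos_add]; congr 1; ring
    have hs2q : Real.sin (g + 2 * q) =
        Real.sin (g + q) * Real.cos q + Real.cos (g + q) * Real.sin q := by
      rw [← Real.sin_add]; congr 1; ring
    rw [hvv]
    simp only [sesq_Jball, cons_val_zero, cons_val_one, cons_val, Complex.star_def,
      Complex.conj_ofReal, mulVec_diagonal, Matrix.trace_diagonal, Fin.sum_univ_three]
    apply Complex.ext
    · simp only [Complex.add_re, Complex.sub_re, Complex.mul_re, Complex.exp_ofReal_mul_I_re,
        Complex.exp_ofReal_mul_I_im, Complex.ofReal_re, Complex.ofReal_im, Complex.re_ofNat,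
        Complex.im_ofNat, Complex.one_re, Complex.one_im, Complex.sub_im, Complex.add_im,
        Complex.mul_im]
      linear_combination -hT + 2 * Real.cos (g + 2 * p) * hxs + 2 * Real.cos (g + 2 * q) * hys -
        2 * Real.cos g * hzs - 2 * Real.sin (g + p) * hx - 2 * Real.sin (g + q) * hy +
        2 * x * (hc2p - hcg) + 2 * y * (hc2q - hcg')
    · simp only [Complex.add_re, Complex.sub_re, Complex.mul_re, Complex.exp_ofReal_mul_I_re,
        Complex.exp_ofReal_mul_I_im, Complex.ofReal_re, Complex.ofReal_im, Complex.re_ofNat,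
        Complex.im_ofNat, Complex.one_re, Complex.one_im, Complex.sub_im, Complex.add_im,
        Complex.mul_im]
      linear_combination 2 * hX + 2 * Real.sin (g + 2 * p) * hxs + 2 * Real.sin (g + 2 * q) * hys -
        2 * Real.sin g * hzs + 2 * Real.cos (g + p) * hx + 2 * Real.cos (g + q) * hy +
        2 * x * (hs2p - hsg) + 2 * y * (hs2q - hsg')

theorem hasHyperbolicRoot_one : HasHyperbolicRoot Jball 1 := by
  refine ⟨diagonal ![-1, -1, 1], ![1, 1, 1], 1, -5, one_ne_zero, ?_, ?_, ?_, by norm_num, ?_, ?_⟩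
  · ext i j; fin_cases i <;> fin_cases j <;> simp [Jball]
  · simp [Fin.prod_univ_three]
  · ext i j; fin_cases i <;> fin_cases j <;> simp [sq]
  · simp [sesq_Jball]
  · simp [sesq_Jball, mulVec_diagonal, Fin.sum_univ_three]; norm_num

theorem exists_exp_four_mul {z : ℂ} (hz : star z * z = 1) :
    ∃ p : ℝ, 0 < p ∧ p ≤ Real.pi / 2 ∧ Complex.exp ((4 * p : ℝ) * Complex.I) = z := by
  have hn : ‖z‖ = 1 := by
    rw [Complex.star_def, ← Complex.normSq_eq_conj_mul_self, Complex.normSq_eq_norm_sq] at hz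
    have : ‖z‖ ^ 2 = 1 := by exact_mod_cast hz
    exact (pow_eq_one_iff_of_nonneg (norm_nonneg z) two_ne_zero).1 this
  have h := Complex.norm_mul_exp_arg_mul_I z
  rw [hn, Complex.ofReal_one, one_mul] at h
  have h1 := Complex.neg_pi_lt_arg z
  have h2 := Complex.arg_le_pi z
  rcases lt_or_ge 0 z.arg with h0 | h0
  · refine ⟨z.arg / 4, by linarith, by linarith, ?_⟩
    rw [mul_div_cancel₀ _ four_ne_zero, h]
  · refine ⟨z.arg / 4 + Real.pi / 2, by linarith, by linarith, ?_⟩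
    rw [show (4 * (z.arg / 4 + Real.pi / 2) : ℝ) * Complex.I =
      z.arg * Complex.I + 2 * Real.pi * Complex.I by push_cast; ring, Complex.exp_add, h,
      Complex.exp_two_pi_mul_I, mul_one]

theorem exists_pow_six {z : ℂ} (hz : star z * z = 1) :
    ∃ C S : ℝ, C ^ 2 + S ^ 2 = 1 ∧ 0 < C ∧ 0 < S ∧ (⟨C, S⟩ : ℂ) ^ 6 = z := by
  obtain ⟨p, hp0, hp1, hp⟩ := exists_exp_four_mul hz
  have hpi := Real.pi_pos
  refine ⟨Real.cos (2 * p / 3), Real.sin (2 * p / 3), Real.cos_sq_add_sin_sq _,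
    Real.cos_pos_of_mem_Ioo ⟨by linarith, by linarith⟩,
    Real.sin_pos_of_pos_of_lt_pi (by linarith) (by linarith), ?_⟩
  have : (⟨Real.cos (2 * p / 3), Real.sin (2 * p / 3)⟩ : ℂ) =
      Complex.exp ((2 * p / 3 : ℝ) * Complex.I) := by
    apply Complex.ext
    · rw [Complex.exp_ofReal_mul_I_re]
    · rw [Complex.exp_ofReal_mul_I_im]
  rw [this, ← Complex.exp_nat_mul, ← hp]
  congr 1
  push_cast
  ring

theorem hasHyperbolicRoot_elliptic_of_le {p q : ℝ} (hp : 0 < p) (hpq : p ≤ q)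
    (hq : q ≤ Real.pi / 2) :
    HasHyperbolicRoot Jball (diagonal ![Complex.exp ((4 * p : ℝ) * Complex.I),
      Complex.exp ((4 * q : ℝ) * Complex.I), 1]) := by
  rcases hq.lt_or_eq with hq' | rfl
  · have h := hasHyperbolicRoot_elliptic hp (show p < q + Real.pi / 2 by linarith)
      (by linarith) (by linarith) (by linarith)
    rwa [show (4 * (q + Real.pi / 2) : ℝ) * Complex.I =
      (4 * q : ℝ) * Complex.I + 2 * Real.pi * Complex.I by push_cast; ring,
      Complex.exp_add ((4 * q : ℝ) * Complex.I), Complex.exp_two_pi_mul_I, mul_one] at h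
  · rcases hpq.lt_or_eq with hp' | rfl
    · exact hasHyperbolicRoot_elliptic hp hp' (by linarith) (by linarith) (by linarith)
    · convert hasHyperbolicRoot_one
      rw [show (4 * (Real.pi / 2) : ℝ) * Complex.I = 2 * Real.pi * Complex.I by push_cast; ring,
        Complex.exp_two_pi_mul_I]
      ext i j
      fin_cases i <;> fin_cases j <;> rfl

theorem HasHyperbolicRoot.swap {α β γ : ℂ} (h : HasHyperbolicRoot Jball (diagonal ![α, β, γ])) :
    HasHyperbolicRoot Jball (diagonal ![β, α, γ]) := by
  refine h.of_conj (P := !![0, 1, 0; 1, 0, 0; 0, 0, 1]) ?_ ?_ ?_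
  · simp [Matrix.det_fin_three]
  · ext i j
    fin_cases i <;> fin_cases j <;> simp [Jball, Matrix.mul_apply, Fin.sum_univ_three]
  · ext i j
    fin_cases i <;> fin_cases j <;> simp [Matrix.mul_apply, Fin.sum_univ_three]

theorem hasHyperbolicRoot_diagonal {α β γ : ℂ} (hα : star α * α = 1) (hβ : star β * β = 1)
    (hγ : star γ * γ = 1) : HasHyperbolicRoot Jball (diagonal ![α, β, γ]) := by
  have hγ0 : γ ≠ 0 := by rintro rfl; simp at hγ
  have key : ∀ {z : ℂ}, star z * z = 1 → star (star γ * z) * (star γ * z) = 1 := by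
    intro z hz
    rw [star_mul', star_star]
    linear_combination hz + star z * z * hγ
  have back : ∀ z : ℂ, γ * (star γ * z) = z := fun z => by linear_combination z * hγ
  obtain ⟨p, hp0, hp1, hp⟩ := exists_exp_four_mul (key hα)
  obtain ⟨q, hq0, hq1, hq⟩ := exists_exp_four_mul (key hβ)
  suffices h : HasHyperbolicRoot Jball (diagonal ![star γ * α, star γ * β, 1]) by
    convert h.smul hγ0
    rw [← diagonal_smul]
    congr 1
    ext i
    fin_cases i <;> simp only [Pi.smul_apply, smul_eq_mul, Fin.zero_eta, Fin.mk_one,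
      Fin.reduceFinMk, cons_val_zero, cons_val_one, cons_val, back, mul_one]
  rw [← hp, ← hq]
  rcases le_total p q with h | h
  · exact hasHyperbolicRoot_elliptic_of_le hp0 h hq1
  · exact (hasHyperbolicRoot_elliptic_of_le hq0 h hp1).swap

theorem hasHyperbolicRoot_siegel_diagonal {l m n : ℂ} (hln : star l * n = 1)
    (hm : star m * m = 1) (hl : star l * l ≠ 1) :
    HasHyperbolicRoot siegelForm (diagonal ![l, m, n]) := by
  have hl0 : l ≠ 0 := by rintro rfl; simp at hln
  have hm0 : m ≠ 0 := by rintro rfl; simp at hm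
  have hr : 0 < ‖l‖ := norm_pos_iff.2 hl0
  have hll : star l * l = (‖l‖ : ℂ) ^ 2 := by
    rw [Complex.star_def, ← Complex.normSq_eq_conj_mul_self, Complex.normSq_eq_norm_sq]
    push_cast; rfl
  have hrc : (‖l‖ : ℂ) ≠ 0 := Complex.ofReal_ne_zero.2 hr.ne'
  obtain ⟨C, S, h1, hC, -, h6⟩ := exists_pow_six (z := l * star m / ‖l‖) (by
    rw [star_div₀, star_mul', star_star, show star (‖l‖ : ℂ) = ‖l‖ from Complex.conj_ofReal _]
    field_simp
    linear_combination hll + star l * l * hm)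
  have hρ : √‖l‖ ^ 2 = ‖l‖ := Real.sq_sqrt hr.le
  have hρc : ((√‖l‖ : ℝ) : ℂ) ^ 2 = ‖l‖ := by exact_mod_cast hρ
  have h := hasHyperbolicRoot_loxodromic h1 hC (Real.sqrt_pos.2 hr) (by
    intro h
    rw [h, one_pow] at hρ
    apply hl
    rw [hll, ← hρ]; simp)
  have hu : star (⟨C, S⟩ : ℂ) * ⟨C, S⟩ = 1 := by
    apply Complex.ext <;> simp <;> linarith
  have hu0 : (⟨C, S⟩ : ℂ) ≠ 0 := by
    rintro h
    rw [h] at hu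
    simp at hu
  set u : ℂ := ⟨C, S⟩
  have h6' : u ^ 6 * ‖l‖ = l * star m := by rw [h6, div_mul_cancel₀ _ hrc]
  have h7 : u ^ 6 = n * star m * ‖l‖ := by
    apply mul_right_cancel₀ hrc
    apply mul_left_cancel₀ (star_ne_zero.2 hl0)
    linear_combination star l * h6' + star m * hll - star m * ‖l‖ ^ 2 * hln
  convert h.smul (mul_ne_zero hm0 (pow_ne_zero 4 hu0))
  rw [sq, diagonal_mul_diagonal, ← diagonal_smul]
  congr 1
  ext i
  fin_cases i <;> simp only [Pi.smul_apply, smul_eq_mul, Fin.zero_eta, Fin.mk_one,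
      Fin.reduceFinMk, cons_val_zero, cons_val_one, cons_val]
  · linear_combination -m * u ^ 6 * hρc - m * h6' - l * hm
  · linear_combination -m * (star u * u + 1) * ((star u * u) ^ 2 + 1) * hu
  · rw [Complex.ofReal_inv]
    have : ((√‖l‖ : ℝ) : ℂ) ≠ 0 := Complex.ofReal_ne_zero.2 (Real.sqrt_pos.2 hr).ne'
    field_simp
    linear_combination n * hρc - m * h7 - n * ‖l‖ * hm

theorem form_eq_of_conj {G G' A A' P : Matrix (Fin 3) (Fin 3) ℂ} (hP : Pᴴ * G * P = G')
    (hA : Aᴴ * G * A = G) (h : A * P = P * A') : A'ᴴ * G' * A' = G' := by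
  calc A'ᴴ * G' * A' = (P * A')ᴴ * G * (P * A') := by
        rw [← hP]; simp only [conjTranspose_mul, Matrix.mul_assoc]
    _ = Pᴴ * (Aᴴ * G * A) * P := by
        rw [← h]; simp only [conjTranspose_mul, Matrix.mul_assoc]
    _ = G' := by rw [hA, hP]

theorem hasHyperbolicRoot_siegel_center {l c m n : ℂ} (hln : star l * n = 1)
    (hm : star m * m = 1) (hc : star c * n + star n * c = 0) :
    HasHyperbolicRoot siegelForm !![l, 0, c; 0, m, 0; 0, 0, n] := by
  have hnl : star n * l = 1 := by simpa [mul_comm] using congrArg star hln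
  by_cases hl : star l * l = 1
  · have hl0 : l ≠ 0 := by rintro rfl; simp at hl
    obtain rfl : n = l := mul_left_cancel₀ (star_ne_zero.2 hl0) (hln.trans hl.symm)
    obtain ⟨t, ht⟩ : ∃ t : ℝ, star n * c = 2 * t * Complex.I := by
      refine ⟨(star n * c).im / 2, ?_⟩
      have h : (star n * c).re = 0 := by
        have := congrArg Complex.re hc
        simp at this ⊢
        linarith
      apply Complex.ext
      · rw [h]; simp
      · simp; ring
    have hct : c = n * (2 * t * Complex.I) := by rw [← ht]; linear_combination -c * hl
    rcases eq_or_ne t 0 with rfl | ht0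
    · have hc0 : c = 0 := by rw [hct]; simp
      subst hc0
      refine (hasHyperbolicRoot_diagonal hl hm hl).of_conj
        (P := !![1, 0, 1; 0, 1, 0; 1 / 2, 0, -(1 / 2)]) ?_ ?_ ?_
      · simp [Matrix.det_fin_three]
        norm_num
      · ext i j
        fin_cases i <;> fin_cases j <;>
          simp [siegelForm, Jball, Matrix.mul_apply, Fin.sum_univ_three, Complex.conj_ofNat] <;>
          norm_num
      · ext i j
        fin_cases i <;> fin_cases j <;>
          simp [Matrix.mul_apply, Fin.sum_univ_three, Matrix.diagonal_apply] <;> ring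
    · have hm' : star (star n * m) * (star n * m) = 1 := by
        rw [star_mul', star_star]
        linear_combination hm + star m * m * hl
      have h : HasHyperbolicRoot siegelForm
          !![1, 0, 2 * t * Complex.I; 0, star n * m, 0; 0, 0, 1] := by
        rcases ht0.lt_or_gt with ht' | ht'
        · obtain ⟨C, S, h1, hC, hS, h6⟩ := exists_pow_six hm'
          have h2 := hasHyperbolicRoot_ellipto_parabolic (C := C) (S := -S) (t := t)
            (by linarith) hC (by nlinarith)
          rwa [show star (⟨C, -S⟩ : ℂ) = ⟨C, S⟩ by apply Complex.ext <;> simp, h6] at h2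
        · obtain ⟨C, S, h1, hC, hS, h6⟩ := exists_pow_six (z := star (star n * m))
            (by rw [star_star, mul_comm, hm'])
          have h2 := hasHyperbolicRoot_ellipto_parabolic h1 hC (mul_pos hS ht')
          rwa [← star_pow, h6, star_star] at h2
      convert h.smul hl0
      have hnm : n * (star n * m) = m := by linear_combination m * hl
      ext i j
      fin_cases i <;> fin_cases j <;> simp [← hct]
      rw [← Complex.star_def, hnm]
  · have hne : n - l ≠ 0 := by
      intro h
      rw [sub_eq_zero.1 h] at hln
      exact hl hln
    have hne' : star n - star l ≠ 0 := by rw [← star_sub]; exact star_ne_zero.2 hne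
    obtain ⟨x, hx⟩ : ∃ x, x = c / (n - l) := ⟨_, rfl⟩
    have hx1 : x * (n - l) = c := by rw [hx, div_mul_cancel₀ _ hne]
    have hx2 : x + star x = 0 := by
      rw [hx, star_div₀, star_sub]
      field_simp
      linear_combination (1 - star l * l) * hc + star c * l * hln + c * star l * hnl
    refine (hasHyperbolicRoot_siegel_diagonal hln hm hl).of_conj
      (P := !![1, 0, x; 0, 1, 0; 0, 0, 1]) ?_ ?_ ?_
    · simp [Matrix.det_fin_three]
    · ext i j
      fin_cases i <;> fin_cases j <;>
        simp [siegelForm, Matrix.mul_apply, Fin.sum_univ_three]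
      exact hx2
    · ext i j
      fin_cases i <;> fin_cases j <;>
        simp [Matrix.mul_apply, Fin.sum_univ_three, Matrix.diagonal_apply]
      linear_combination -hx1

theorem hasHyperbolicRoot_siegel_triangular {l b c m d n : ℂ} (hln : star l * n = 1)
    (hm : star m * m = 1) (hbd : star b * n + star m * d = 0)
    (hc : star c * n + star d * d + star n * c = 0) :
    HasHyperbolicRoot siegelForm !![l, b, c; 0, m, d; 0, 0, n] := by
  have hnl : star n * l = 1 := by simpa [mul_comm] using congrArg star hln
  have hd : d = -(star b * n * m) := by linear_combination m * hbd - d * hm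
  have hsd : star d = -(b * star n * star m) := by
    rw [hd, star_neg, star_mul', star_mul', star_star]
  rcases eq_or_ne l m with rfl | hlm
  · have hl0 : l ≠ 0 := by rintro rfl; simp at hm
    obtain rfl : n = l := mul_left_cancel₀ (star_ne_zero.2 hl0) (hln.trans hm.symm)
    rcases eq_or_ne b 0 with rfl | hb
    · obtain rfl : d = 0 := by rw [hd]; simp
      exact hasHyperbolicRoot_siegel_center hln hm (by simpa using hc)
    · have h := hasHyperbolicRoot_unipotent (b := star n * b) (c := star n * c)
        (mul_ne_zero (star_ne_zero.2 hl0) hb) (by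
          rw [star_mul', star_mul', star_star]
          rw [hsd, hd] at hc
          linear_combination hc - star n * n * star b * b * hm)
      convert h.smul hl0
      have hn : ∀ z, n * (star n * z) = z := fun z => by linear_combination z * hm
      ext i j
      fin_cases i <;> fin_cases j <;> simp
      all_goals simp only [← Complex.star_def, hn]
      rw [hd]
      ring
  · have hne : m - l ≠ 0 := sub_ne_zero.2 hlm.symm
    have hne' : star m - star l ≠ 0 := by rw [← star_sub]; exact star_ne_zero.2 hne
    obtain ⟨x, hx⟩ : ∃ x, x = b / (m - l) := ⟨_, rfl⟩
    have hx1 : x * (m - l) = b := by rw [hx, div_mul_cancel₀ _ hne]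
    have hx2 : star x * (star m - star l) = star b := by rw [← hx1, star_mul', star_sub]
    have hx3 : star x * (m - n) = d := by
      rw [hd, ← hx2]
      linear_combination star x * n * hm - star x * m * hln
    have hx4 : x * (star m - star n) = star d := by
      rw [← hx3, star_mul', star_sub, star_star]
    set y := -(x * star x) / 2 with hy
    have hy' : star y = y := by
      rw [hy]
      simp only [star_div₀, star_neg, star_star, star_mul', star_ofNat]
      ring
    have hG : (!![1, x, y; 0, 1, -star x; 0, 0, 1] : Matrix (Fin 3) (Fin 3) ℂ)ᴴ * siegelForm *
        !![1, x, y; 0, 1, -star x; 0, 0, 1] = siegelForm := by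
      ext i j
      fin_cases i <;> fin_cases j <;>
        simp [siegelForm, Matrix.mul_apply, Fin.sum_univ_three]
      simp only [← Complex.star_def, hy']
      rw [hy]
      ring
    refine (hasHyperbolicRoot_siegel_center (c := l * y - b * star x + c - y * n) hln hm
      ?_).of_conj (P := !![1, x, y; 0, 1, -star x; 0, 0, 1]) ?_ hG ?_
    · simp only [star_add, star_sub, star_mul', star_star, hy']
      rw [← hx4, ← hx3] at hc
      rw [← hx2, ← hx1, hy]
      linear_combination hc + x * star x / 2 * (hln + hnl) - x * star x * hm
    · simp [Matrix.det_fin_three]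
    · ext i j
      fin_cases i <;> fin_cases j <;>
        simp [Matrix.mul_apply, Fin.sum_univ_three]
      · linear_combination -hx1
      · ring
      · rw [← Complex.star_def]
        linear_combination -hx3

theorem conjTranspose_mul_mul_apply (G P : Matrix (Fin 3) (Fin 3) ℂ) (i j : Fin 3) :
    (Pᴴ * G * P) i j = sesq G (P.col i) (P.col j) := by
  simp [sesq, Matrix.mul_apply, Matrix.mulVec, dotProduct, Fin.sum_univ_three]
  ring

theorem isUnit_det_of_form {G G' P : Matrix (Fin 3) (Fin 3) ℂ} (hG' : G'.det ≠ 0)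
    (h : Pᴴ * G * P = G') : IsUnit P.det := by
  rw [isUnit_iff_ne_zero]
  rintro h0
  rw [← h, det_mul, h0, mul_zero] at hG'
  exact hG' rfl

theorem InU21.star_mul_self_eq_one {A : Matrix (Fin 3) (Fin 3) ℂ} (hA : InU21 A)
    {x : Fin 3 → ℂ} {l : ℂ} (hx : A *ᵥ x = l • x) (h : sesq Jball x x ≠ 0) : star l * l = 1 := by
  have h1 := hA.sesq_mulVec x x
  rw [hx, sesq_smul_left, sesq_smul_right] at h1
  apply mul_right_cancel₀ h
  linear_combination h1

theorem hasHyperbolicRoot_of_null_eigenvector {A : Matrix (Fin 3) (Fin 3) ℂ} (hA : InU21 A)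
    {x : Fin 3 → ℂ} {l : ℂ} (hx0 : x ≠ 0) (hx : A *ᵥ x = l • x) (h : sesq Jball x x = 0) :
    HasHyperbolicRoot Jball A := by
  have hx2 := apply_two_ne_zero hx0 (by simp [h])
  obtain ⟨a, b, hab, hv⟩ : ∃ a b : ℂ, star a * a + star b * b = 1 ∧
      A *ᵥ ![a, b, 1] = l • ![a, b, 1] := by
    have hv : (x 2)⁻¹ • x = ![(x 2)⁻¹ * x 0, (x 2)⁻¹ * x 1, 1] := by
      ext i; fin_cases i <;> simp [hx2]
    refine ⟨(x 2)⁻¹ * x 0, (x 2)⁻¹ * x 1, ?_, ?_⟩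
    · have h2 : sesq Jball ((x 2)⁻¹ • x) ((x 2)⁻¹ • x) = 0 := by
        rw [sesq_smul_left, sesq_smul_right, h, mul_zero, mul_zero]
      rw [hv, sesq_Jball] at h2
      simp only [cons_val_zero, cons_val_one, cons_val, star_one] at h2
      linear_combination h2
    · rw [← hv, mulVec_smul, hx, smul_comm]
  set P : Matrix (Fin 3) (Fin 3) ℂ :=
    !![a, -star b, a / 2; b, star a, b / 2; 1, 0, -(1 / 2)] with hP
  have hG : Pᴴ * Jball * P = siegelForm := by
    ext i j
    fin_cases i <;> fin_cases j <;>
      simp [hP, siegelForm, Jball, Matrix.mul_apply, Fin.sum_univ_three, Complex.conj_ofNat] <;>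
      (try simp only [← Complex.star_def]) <;>
      first | ring1 | linear_combination hab | linear_combination hab / 2 |
        linear_combination hab / 4
  have hdet := isUnit_det_of_form (by simp [siegelForm, Matrix.det_fin_three]) hG
  obtain ⟨A', hA'⟩ : ∃ A', A * P = P * A' :=
    ⟨P⁻¹ * (A * P), (mul_nonsing_inv_cancel_left _ _ hdet).symm⟩
  have hG' := form_eq_of_conj hG hA hA'
  have hcol : A'.col 0 = l • Pi.single 0 1 := by
    have h1 : P *ᵥ (A'.col 0) = P *ᵥ (l • Pi.single 0 1) := by
      have hP0 : P *ᵥ Pi.single 0 1 = ![a, b, 1] := by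
        rw [mulVec_single_one]
        ext i; fin_cases i <;> simp [hP]
      rw [mulVec_smul, hP0, ← hv, ← hP0, ← mulVec_single_one, mulVec_mulVec, mulVec_mulVec, hA']
    exact mulVec_injective_of_isUnit ((Matrix.isUnit_iff_isUnit_det P).2 hdet) h1
  have e0 : A' 0 0 = l := by simpa using congrFun hcol 0
  have e1 : A' 1 0 = 0 := by simpa using congrFun hcol 1
  have e2 : A' 2 0 = 0 := by simpa using congrFun hcol 2
  have key : ∀ i j, star (A' 0 i) * A' 2 j + star (A' 1 i) * A' 1 j + star (A' 2 i) * A' 0 j =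
      siegelForm i j := by
    intro i j
    rw [← hG', conjTranspose_mul_mul_apply, sesq_siegelForm]
    simp
  have k02 := key 0 2
  have k01 := key 0 1
  have k11 := key 1 1
  have k12 := key 1 2
  have k22 := key 2 2
  simp only [e0, e1, e2, siegelForm, star_zero, zero_mul, add_zero, Matrix.of_apply,
    cons_val_zero, cons_val_one, cons_val] at k02 k01 k11 k12 k22
  have hl0 : star l ≠ 0 := left_ne_zero_of_mul (k02.trans_ne one_ne_zero)
  have e21 : A' 2 1 = 0 := (mul_eq_zero.1 k01).resolve_left hl0
  simp only [e21, star_zero, mul_zero, zero_mul, add_zero, zero_add] at k11 k12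
  refine HasHyperbolicRoot.of_conj hdet hG hA' ?_
  convert hasHyperbolicRoot_siegel_triangular k02 k11 k12 k22
  ext i j
  fin_cases i <;> fin_cases j <;> simp [e0, e1, e2, e21]

theorem hasHyperbolicRoot_of_orthogonal_eigenvectors {A : Matrix (Fin 3) (Fin 3) ℂ}
    (hA : InU21 A) {x y z : Fin 3 → ℂ} {l m n : ℂ} (hx : A *ᵥ x = l • x) (hy : A *ᵥ y = m • y)
    (hz : A *ᵥ z = n • z) (hxy : sesq Jball x y = 0) (hxz : sesq Jball x z = 0)
    (hyz : sesq Jball y z = 0) (hx0 : 0 < (sesq Jball x x).re) (hy0 : 0 < (sesq Jball y y).re)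
    (hz0 : (sesq Jball z z).re < 0) : HasHyperbolicRoot Jball A := by
  have hne : ∀ {w : ℂ}, w.re ≠ 0 → w ≠ 0 := by rintro _ h rfl; exact h rfl
  have hl := hA.star_mul_self_eq_one hx (hne hx0.ne')
  have hm := hA.star_mul_self_eq_one hy (hne hy0.ne')
  have hn := hA.star_mul_self_eq_one hz (hne hz0.ne)
  have hnorm : ∀ w : Fin 3 → ℂ, (sesq Jball w w).re ≠ 0 → ∃ c : ℂ,
      sesq Jball (c • w) (c • w) = (SignType.sign (sesq Jball w w).re : ℝ) := by
    intro w hw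
    refine ⟨((√|(sesq Jball w w).re|)⁻¹ : ℝ), ?_⟩
    have hr : sesq Jball w w = ((sesq Jball w w).re : ℂ) := by rw [sesq_Jball_self]; simp
    rw [sesq_smul_left, sesq_smul_right, Complex.star_def, Complex.conj_ofReal]
    nth_rewrite 3 [hr]
    norm_cast
    have h1 := Real.sq_sqrt (abs_nonneg (sesq Jball w w).re)
    have h2 : √|(sesq Jball w w).re| ≠ 0 := (Real.sqrt_pos.2 (abs_pos.2 hw)).ne'
    field_simp
    rw [h1, mul_comm, sign_mul_abs]
  obtain ⟨a, ha⟩ := hnorm x hx0.ne'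
  obtain ⟨b, hb⟩ := hnorm y hy0.ne'
  obtain ⟨c, hc⟩ := hnorm z hz0.ne
  rw [sign_pos hx0] at ha
  rw [sign_pos hy0] at hb
  rw [sign_neg hz0] at hc
  have hyx : sesq Jball y x = 0 := by rw [← star_sesq_Jball, hxy, star_zero]
  have hzx : sesq Jball z x = 0 := by rw [← star_sesq_Jball, hxz, star_zero]
  have hzy : sesq Jball z y = 0 := by rw [← star_sesq_Jball, hyz, star_zero]
  have hG : ((Matrix.of ![a • x, b • y, c • z])ᵀ)ᴴ * Jball * (Matrix.of ![a • x, b • y, c • z])ᵀ =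
      Jball := by
    ext i j
    rw [conjTranspose_mul_mul_apply]
    change sesq Jball (![a • x, b • y, c • z] i) (![a • x, b • y, c • z] j) =
      (diagonal ![1, 1, -1] : Matrix (Fin 3) (Fin 3) ℂ) i j
    fin_cases i <;> fin_cases j <;>
      simp [ha, hb, hc] <;>
      simp [sesq_smul_left, sesq_smul_right, hxy, hxz, hyx, hyz, hzx, hzy]
  refine (hasHyperbolicRoot_diagonal hl hm hn).of_conj
    (isUnit_det_of_form (by simp [det_Jball]) hG) hG ?_
  ext i j
  rw [mul_diagonal]
  have e : (A * (Matrix.of ![a • x, b • y, c • z])ᵀ) i j =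
    (A *ᵥ (![a • x, b • y, c • z] j)) i := rfl
  rw [e]
  fin_cases j <;> simp [mulVec_smul, hx, hy, hz] <;> ring

theorem exists_sesq_eq_zero (x y : Fin 3 → ℂ) :
    ∃ z, sesq Jball x z = 0 ∧ sesq Jball y z = 0 ∧
      sesq Jball z z = star (sesq Jball x y) * sesq Jball x y -
        sesq Jball x x * sesq Jball y y := by
  refine ⟨![star (x 1 * y 2 - x 2 * y 1), star (x 2 * y 0 - x 0 * y 2),
    -star (x 0 * y 1 - x 1 * y 0)], ?_, ?_, ?_⟩ <;>
  · simp [sesq_Jball]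
    ring

theorem InU21.sesq_mulVec_eq_zero {A : Matrix (Fin 3) (Fin 3) ℂ} (hA : InU21 A)
    {x y : Fin 3 → ℂ} {l : ℂ} (hx : A *ᵥ x = l • x) (h0 : sesq Jball x x ≠ 0)
    (h : sesq Jball x y = 0) : sesq Jball x (A *ᵥ y) = 0 := by
  have h1 := hA.sesq_mulVec x y
  rw [hx, sesq_smul_left, h] at h1
  refine (mul_eq_zero.1 h1).resolve_left (left_ne_zero_of_mul (b := l) ?_)
  rw [hA.star_mul_self_eq_one hx h0]
  exact one_ne_zero

theorem exists_eigenvector_sesq_eq_zero {A : Matrix (Fin 3) (Fin 3) ℂ} (hA : InU21 A)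
    {x : Fin 3 → ℂ} {l : ℂ} (hx : A *ᵥ x = l • x) (h0 : sesq Jball x x ≠ 0) :
    ∃ (y : Fin 3 → ℂ) (m : ℂ), y ≠ 0 ∧ A *ᵥ y = m • y ∧ sesq Jball x y = 0 := by
  let φ : (Fin 3 → ℂ) →ₗ[ℂ] ℂ :=
    { toFun := sesq Jball x
      map_add' := fun _ _ => sesq_add_right _ _ _ _
      map_smul' := fun _ _ => sesq_smul_right _ _ _ _ }
  have hmaps : ∀ y ∈ LinearMap.ker φ, Matrix.toLin' A y ∈ LinearMap.ker φ := fun y hy =>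
    hA.sesq_mulVec_eq_zero hx h0 hy
  have : Nontrivial (LinearMap.ker φ) :=
    Submodule.nontrivial_iff_ne_bot.2 (LinearMap.ker_ne_bot_of_finrank_lt (by simp))
  obtain ⟨m, hm⟩ := Module.End.exists_eigenvalue ((Matrix.toLin' A).restrict hmaps)
  obtain ⟨y, hy⟩ := hm.exists_hasEigenvector
  refine ⟨y, m, fun h => hy.2 (Subtype.ext h), ?_, y.2⟩
  simpa using congrArg Subtype.val hy.apply_eq_smul

theorem hasHyperbolicRoot_of_eigenvectors {A : Matrix (Fin 3) (Fin 3) ℂ} (hA : InU21 A)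
    {x y : Fin 3 → ℂ} {l m : ℂ} (hx : A *ᵥ x = l • x) (hy : A *ᵥ y = m • y)
    (hxy : sesq Jball x y = 0) (hx0 : sesq Jball x x ≠ 0) (hy0 : sesq Jball y y ≠ 0) :
    HasHyperbolicRoot Jball A := by
  obtain ⟨z, hxz, hyz, hzz⟩ := exists_sesq_eq_zero x y
  rw [hxy, mul_zero, zero_sub] at hzz
  have hz0 : sesq Jball z z ≠ 0 := by
    rw [hzz]
    exact neg_ne_zero.2 (mul_ne_zero hx0 hy0)
  have hyx : sesq Jball y x = 0 := by rw [← star_sesq_Jball, hxy, star_zero]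
  have hzx : sesq Jball z x = 0 := by rw [← star_sesq_Jball, hxz, star_zero]
  have hzy : sesq Jball z y = 0 := by rw [← star_sesq_Jball, hyz, star_zero]
  obtain ⟨n, hz⟩ : ∃ n, A *ᵥ z = n • z := by
    have hP : IsUnit ((Matrix.of ![x, y, z])ᵀ)ᴴ.det := by
      have hG : ((Matrix.of ![x, y, z])ᵀ)ᴴ * Jball * (Matrix.of ![x, y, z])ᵀ =
          diagonal ![sesq Jball x x, sesq Jball y y, sesq Jball z z] := by
        ext i j
        rw [conjTranspose_mul_mul_apply]
        change sesq Jball (![x, y, z] i) (![x, y, z] j) = _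
        fin_cases i <;> fin_cases j <;> simp [*]
      have := isUnit_det_of_form (by simp [Fin.prod_univ_three, hx0, hy0, hz0]) hG
      rw [det_conjTranspose]
      exact this.star
    refine ⟨sesq Jball z (A *ᵥ z) / sesq Jball z z, ?_⟩
    set w := A *ᵥ z - (sesq Jball z (A *ᵥ z) / sesq Jball z z) • z with hw
    have hsub : ∀ v, sesq Jball v w = sesq Jball v (A *ᵥ z) -
        sesq Jball z (A *ᵥ z) / sesq Jball z z * sesq Jball v z := by
      intro v
      rw [hw, sub_eq_add_neg, ← neg_smul, sesq_add_right, sesq_smul_right]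
      ring
    have h1 : ((Matrix.of ![x, y, z])ᵀ)ᴴ *ᵥ (Jball *ᵥ w) = 0 := by
      ext i
      change sesq Jball (![x, y, z] i) w = 0
      rw [hsub]
      fin_cases i
      · simp [hA.sesq_mulVec_eq_zero hx hx0 hxz, hxz]
      · simp [hA.sesq_mulVec_eq_zero hy hy0 hyz, hyz]
      · simp [hz0]
    have h2 : Jball *ᵥ w = 0 :=
      mulVec_injective_of_isUnit ((Matrix.isUnit_iff_isUnit_det _).2 hP)
        (h1.trans (mulVec_zero _).symm)
    have h3 : w = 0 := by
      rw [← one_mulVec w, ← Jball_mul_Jball, ← mulVec_mulVec, h2, mulVec_zero]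
    exact sub_eq_zero.1 h3
  have hre : ∀ v, sesq Jball v v = ((sesq Jball v v).re : ℂ) := fun v => by
    rw [sesq_Jball_self]; simp
  have hre0 : ∀ {v}, sesq Jball v v ≠ 0 → (sesq Jball v v).re ≠ 0 := fun {v} h h' =>
    h (by rw [hre, h', Complex.ofReal_zero])
  have hzr : (sesq Jball z z).re = -((sesq Jball x x).re * (sesq Jball y y).re) := by
    rw [hzz, hre x, hre y]; simp
  rcases (hre0 hx0).lt_or_gt with h1 | h1 <;> rcases (hre0 hy0).lt_or_gt with h2 | h2
  · have h3 := smul_eq_smul_of_sesq_nonpos h1.le h2.le hxy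
    have hx2 := apply_two_ne_zero (by rintro rfl; exact hx0 (sesq_zero_right _ _)) h1.le
    have h4 := congrArg (sesq Jball y) h3
    rw [sesq_smul_right, sesq_smul_right, hyx, mul_zero] at h4
    exact absurd h4.symm (mul_ne_zero hx2 hy0)
  · exact hasHyperbolicRoot_of_orthogonal_eigenvectors hA hy hz hx hyz hyx hzx h2
      (by rw [hzr]; nlinarith) h1
  · exact hasHyperbolicRoot_of_orthogonal_eigenvectors hA hx hz hy hxz hxy hzy h1
      (by rw [hzr]; nlinarith) h2
  · exact hasHyperbolicRoot_of_orthogonal_eigenvectors hA hx hy hz hxy hxz hyz h1 h2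
      (by rw [hzr]; nlinarith)

theorem InU21.hasHyperbolicRoot {A : Matrix (Fin 3) (Fin 3) ℂ} (hA : InU21 A) :
    HasHyperbolicRoot Jball A := by
  obtain ⟨l, hl⟩ := Module.End.exists_eigenvalue (Matrix.toLin' A)
  obtain ⟨x, hx⟩ := hl.exists_hasEigenvector
  have hx1 : A *ᵥ x = l • x := by simpa using hx.apply_eq_smul
  by_cases hx0 : sesq Jball x x = 0
  · exact hasHyperbolicRoot_of_null_eigenvector hA hx.2 hx1 hx0
  obtain ⟨y, m, hy, hy1, hxy⟩ := exists_eigenvector_sesq_eq_zero hA hx1 hx0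
  by_cases hy0 : sesq Jball y y = 0
  · exact hasHyperbolicRoot_of_null_eigenvector hA hy hy1 hy0
  · exact hasHyperbolicRoot_of_eigenvectors hA hx1 hy1 hxy hx0 hy0

/-- Every element of PU(2,1) is the square of a triple product of involutions. -/
theorem square_of_triple_product (A : Matrix (Fin 3) (Fin 3) ℂ) (hA : InU21 A) :
    ∃ (I₁ I₂ I₃ : Matrix (Fin 3) (Fin 3) ℂ) (c : ℂ),
      c ≠ 0 ∧ IsInvLift I₁ ∧ IsInvLift I₂ ∧ IsInvLift I₃ ∧
      A = c • (I₁ * I₂ * I₃) ^ 2 :=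
  hA.hasHyperbolicRoot.exists_isInvLift
end

section
/- Every element of PSL(2,ℝ) is a product of at most three half-turns: for every A in SL(2,ℝ) there exist B, C, D in SL(2,ℝ), each satisfying B² = 1 or B² = −1 (and likewise for C and D), such that A = B·C·D or A = −(B·C·D). -/
open Matrix in
theorem sl2_mul_apply (M N : SpecialLinearGroup (Fin 2) ℝ) (i j : Fin 2) :
    (M * N) i j = M i 0 * N 0 j + M i 1 * N 1 j := by
  change ((M : Matrix (Fin 2) (Fin 2) ℝ) * (N : Matrix (Fin 2) (Fin 2) ℝ)) i j = _
  rw [Matrix.mul_apply, Fin.sum_univ_two]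

open Matrix in
/-- A matrix in `SL(2,ℝ)` of trace zero squares to `-1` (Cayley–Hamilton). -/
theorem sl2_sq_eq_neg_one_of_trace_eq_zero (B : SpecialLinearGroup (Fin 2) ℝ)
    (h : B 0 0 + B 1 1 = 0) : B ^ 2 = -1 := by
  have hd := B.det_coe
  rw [det_fin_two] at hd
  have h1 : B 1 1 = -B 0 0 := by linarith
  rw [h1] at hd
  ext i j
  fin_cases i <;> fin_cases j <;>
    simp [pow_two, Matrix.mul_apply, Fin.sum_univ_two, h1] <;> linarith

open Matrix in
/-- A matrix in `SL(2,ℝ)` with nonzero lower left entry is a product of three half-turns. -/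
theorem sl2_eq_mul_half_turns_of_lower_left_ne_zero (A : SpecialLinearGroup (Fin 2) ℝ)
    (hr : A 1 0 ≠ 0) :
    ∃ B C D : SpecialLinearGroup (Fin 2) ℝ,
      B ^ 2 = -1 ∧ C ^ 2 = -1 ∧ D ^ 2 = -1 ∧ A = B * C * D := by
  have hd := A.det_coe
  rw [det_fin_two] at hd
  -- `B * A` is upper triangular with diagonal `-2, -1/2`, hence hyperbolic.
  let B : SpecialLinearGroup (Fin 2) ℝ :=
    ⟨!![A 0 0 / 2, -(1 + (A 0 0 / 2) ^ 2) * 2 / A 1 0; A 1 0 / 2, -(A 0 0 / 2)], by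
      rw [det_fin_two_of]; field_simp; ring⟩
  let x : ℝ := 2 / 3 * (B * A) 0 1
  let C : SpecialLinearGroup (Fin 2) ℝ :=
    ⟨!![x, -(1 + x ^ 2); 1, -x], by rw [det_fin_two_of]; ring⟩
  have hB : B ^ 2 = -1 := sl2_sq_eq_neg_one_of_trace_eq_zero B (by simp [B])
  have hC : C ^ 2 = -1 := sl2_sq_eq_neg_one_of_trace_eq_zero C (by simp [C])
  have h00 : (B * A) 0 0 = -2 := by
    rw [sl2_mul_apply]; simp [B]; field_simp; ring
  have h10 : (B * A) 1 0 = 0 := by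
    rw [sl2_mul_apply]; simp [B]; ring
  have h11 : (B * A) 1 1 = -1 / 2 := by
    rw [sl2_mul_apply]; simp [B]; linarith
  refine ⟨B, C, C * (B * A), hB, hC, sl2_sq_eq_neg_one_of_trace_eq_zero _ ?_, ?_⟩
  · rw [sl2_mul_apply, sl2_mul_apply C, h00, h10, h11]
    simp [C, x]
    ring
  · calc A = B ^ 2 * C ^ 2 * A := by rw [hB, hC]; simp
      _ = B * C * (C * (B * A)) := by
        rw [hC, mul_assoc B C, ← mul_assoc C C, ← pow_two C, hC, pow_two]
        simp [mul_assoc]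

/-- Every element of PSL(2,ℝ) is a product of at most three half-turns: every element
of SL(2,ℝ) is, up to sign, a product of three matrices each squaring to ±1. -/
theorem psl2_product_of_three_half_turns (A : Matrix.SpecialLinearGroup (Fin 2) ℝ) :
    ∃ B C D : Matrix.SpecialLinearGroup (Fin 2) ℝ,
      (B ^ 2 = 1 ∨ ((B : Matrix (Fin 2) (Fin 2) ℝ)) ^ 2 = -1) ∧
      (C ^ 2 = 1 ∨ ((C : Matrix (Fin 2) (Fin 2) ℝ)) ^ 2 = -1) ∧
      (D ^ 2 = 1 ∨ ((D : Matrix (Fin 2) (Fin 2) ℝ)) ^ 2 = -1) ∧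
      (A = B * C * D ∨
        (A : Matrix (Fin 2) (Fin 2) ℝ) = -((B * C * D : Matrix.SpecialLinearGroup (Fin 2) ℝ) :
          Matrix (Fin 2) (Fin 2) ℝ)) := by
  have coe_sq (M : Matrix.SpecialLinearGroup (Fin 2) ℝ) (h : M ^ 2 = -1) :
      (M : Matrix (Fin 2) (Fin 2) ℝ) ^ 2 = -1 := by
    rw [← Matrix.SpecialLinearGroup.coe_pow, h]
    simp
  by_cases hr : A 1 0 = 0
  · by_cases hq : A 0 1 = 0
    · let J : Matrix.SpecialLinearGroup (Fin 2) ℝ :=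
        ⟨!![0, -1; 1, 0], by simp [Matrix.det_fin_two_of]⟩
      have hJ : J ^ 2 = -1 := sl2_sq_eq_neg_one_of_trace_eq_zero J (by simp [J])
      have hD : (J * A) ^ 2 = -1 := sl2_sq_eq_neg_one_of_trace_eq_zero _
        (by rw [sl2_mul_apply, sl2_mul_apply]; simp [J, hr, hq])
      refine ⟨1, J, J * A, .inl (one_pow 2), .inr (coe_sq J hJ), .inr (coe_sq _ hD), .inr ?_⟩
      rw [one_mul, ← mul_assoc, ← pow_two, hJ]
      simp
    · obtain ⟨B, C, D, hB, hC, hD, h⟩ :=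
        sl2_eq_mul_half_turns_of_lower_left_ne_zero A.transpose
          (by simpa [Matrix.SpecialLinearGroup.coe_transpose] using hq)
      have transpose_sq (M : Matrix.SpecialLinearGroup (Fin 2) ℝ) (hM : M ^ 2 = -1) :
          (M.transpose : Matrix (Fin 2) (Fin 2) ℝ) ^ 2 = -1 := by
        rw [Matrix.SpecialLinearGroup.coe_transpose, ← Matrix.transpose_pow, coe_sq M hM]
        simp
      refine ⟨D.transpose, C.transpose, B.transpose, .inr (transpose_sq D hD),
        .inr (transpose_sq C hC), .inr (transpose_sq B hB), .inl (Subtype.ext ?_)⟩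
      have h' := congrArg (fun M : Matrix.SpecialLinearGroup (Fin 2) ℝ =>
        (M : Matrix (Fin 2) (Fin 2) ℝ).transpose) h
      simpa [Matrix.SpecialLinearGroup.coe_transpose, Matrix.transpose_mul, mul_assoc] using h'
  · obtain ⟨B, C, D, hB, hC, hD, h⟩ := sl2_eq_mul_half_turns_of_lower_left_ne_zero A hr
    exact ⟨B, C, D, .inr (coe_sq B hB), .inr (coe_sq C hC), .inr (coe_sq D hD), .inl h⟩
end

section
/- Every elliptic isometry of the hyperbolic plane is a product of two hyperbolic isometries lying in any two prescribed hyperbolic conjugacy classes: for all real numbers t₁ > 2 and t₂ > 2, and every E ∈ SL(2,ℝ) with |trace(E)| < 2, there exist h₁, h₂ ∈ SL(2,ℝ) with trace(h₁) = t₁ and trace(h₂) = t₂ such that E = h₁·h₂ or E = −(h₁·h₂). -/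
/-- The off-diagonal entries of an elliptic matrix have opposite signs. -/
theorem offDiag_mul_neg_of_elliptic {a b c d : ℝ} (hdet : a * d - b * c = 1)
    (htr : |a + d| < 2) : b * c < 0 := by
  obtain ⟨h₁, h₂⟩ := abs_lt.1 htr
  nlinarith [sq_nonneg (a - d)]

theorem exists_mul_eq_and_linear_eq {b c k : ℝ} (hbc : b * c < 0) (hk : 0 < k) (M : ℝ) :
    ∃ q r : ℝ, q * r = k ∧ q * c + r * b = M := by
  have hc : c ≠ 0 := right_ne_zero_of_mul hbc.ne
  have hb : b ≠ 0 := left_ne_zero_of_mul hbc.ne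
  have hdisc : 0 ≤ discrim c (-M) (k * b) := by
    unfold discrim
    nlinarith [sq_nonneg M, mul_pos hk (neg_pos.2 hbc)]
  obtain ⟨q, hq⟩ := exists_quadratic_eq_zero hc ⟨_, (Real.mul_self_sqrt hdisc).symm⟩
  have hq0 : q ≠ 0 := by
    rintro rfl
    simp [hk.ne', hb] at hq
  refine ⟨q, k / q, mul_div_cancel₀ k hq0, ?_⟩
  field_simp
  linarith


/-- Every elliptic isometry of the hyperbolic plane is a product of two hyperbolic
isometries lying in any two prescribed hyperbolic conjugacy classes. -/
theorem elliptic_product_two_hyperbolic_prescribed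
    (t₁ t₂ : ℝ) (ht₁ : 2 < t₁) (ht₂ : 2 < t₂)
    (E : Matrix.SpecialLinearGroup (Fin 2) ℝ)
    (hE : |Matrix.trace (E : Matrix (Fin 2) (Fin 2) ℝ)| < 2) :
    ∃ h₁ h₂ : Matrix.SpecialLinearGroup (Fin 2) ℝ,
      Matrix.trace (h₁ : Matrix (Fin 2) (Fin 2) ℝ) = t₁ ∧
      Matrix.trace (h₂ : Matrix (Fin 2) (Fin 2) ℝ) = t₂ ∧
      (E = h₁ * h₂ ∨
        (E : Matrix (Fin 2) (Fin 2) ℝ) = -((h₁ * h₂ : Matrix.SpecialLinearGroup (Fin 2) ℝ) :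
          Matrix (Fin 2) (Fin 2) ℝ)) := by
  have hdet : E 0 0 * E 1 1 - E 0 1 * E 1 0 = 1 := by
    rw [← Matrix.det_fin_two, E.det_coe]
  rw [Matrix.trace_fin_two] at hE
  have hbc := offDiag_mul_neg_of_elliptic hdet hE
  obtain ⟨q, r, hqr, hlin⟩ := exists_mul_eq_and_linear_eq hbc
    (show 0 < t₁ ^ 2 / 4 - 1 by nlinarith) (t₂ - t₁ / 2 * (E 0 0 + E 1 1))
  obtain ⟨X, hX⟩ : ∃ X : Matrix.SpecialLinearGroup (Fin 2) ℝ,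
      (X : Matrix (Fin 2) (Fin 2) ℝ) = !![t₁ / 2, q; r, t₁ / 2] :=
    ⟨⟨_, by rw [Matrix.det_fin_two_of]; linarith⟩, rfl⟩
  refine ⟨X⁻¹, X * E, ?_, ?_, Or.inl (inv_mul_cancel_left X E).symm⟩
  · rw [Matrix.SpecialLinearGroup.coe_inv, hX, Matrix.adjugate_fin_two_of,
      Matrix.trace_fin_two_of, add_halves]
  · rw [Matrix.SpecialLinearGroup.coe_mul, hX, Matrix.trace_fin_two]
    simp only [Matrix.mul_apply, Fin.sum_univ_two, Matrix.of_apply, Matrix.cons_val',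
      Matrix.cons_val_zero, Matrix.cons_val_one, Matrix.cons_val_fin_one]
    linarith
end
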